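/- There exists an absolute constant A > 0 such that for every Q > 1, every weight w on [0,1) with dyadic A₂ characteristic [w]_{A₂} ≤ Q, every measurable function φ on [0,1) with ∫_0^1 φ² w^{-1} dx < ∞, and every dyadic interval J ⊆ [0,1), one has (1/|J|) Σ_{I ∈ D(J)} ( ⟨φ w^{-1}⟩_I / ⟨w^{-1}⟩_I )² γ_I |I| ≤ A Q² ⟨φ² w^{-1}⟩_J, where γ_I = (Δ_I w^{-1})² ⟨w⟩_I. -/

import Mathlib

open MeasureTheory

noncomputable section

/-- The dyadic interval `[k/2^n, (k+1)/2^n)`. -/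
def dyadicI (n k : ℕ) : Set ℝ := Set.Ico ((k : ℝ) / 2 ^ n) (((k : ℝ) + 1) / 2 ^ n)

/-- The length of a dyadic interval of generation `n`. -/
def dyadicLen (n : ℕ) : ℝ := 1 / 2 ^ n

/-- The average `⟨f⟩_I` of `f` over the dyadic interval `I = (n,k)`. -/
def avg (f : ℝ → ℝ) (n k : ℕ) : ℝ := (2 : ℝ) ^ n * ∫ x in dyadicI n k, f x

/-- The martingale difference `Δ_I f = ⟨f⟩_{I₊} - ⟨f⟩_{I₋}` for `I = (n,k)`. -/
def haarDiff (f : ℝ → ℝ) (n k : ℕ) : ℝ :=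
  avg f (n + 1) (2 * k + 1) - avg f (n + 1) (2 * k)

/-- `γ_I = (Δ_I w⁻¹)² ⟨w⟩_I` for `I = (n,k)`. -/
def gammaI (w : ℝ → ℝ) (n k : ℕ) : ℝ :=
  (haarDiff (fun x => (w x)⁻¹) n k) ^ 2 * avg w n k

/-- A discrete convexity estimate for `(u, v) ↦ u v² + 2 Q² / u` on the region `u v ≤ Q`. -/
lemma bellman_convexity {Q u₁ u₂ v₁ v₂ : ℝ} (hu₁ : 0 < u₁) (hu₂ : 0 < u₂) (hv₁ : 0 < v₁)
    (hv₂ : 0 < v₂) (hQ : (u₁ + u₂) / 2 * ((v₁ + v₂) / 2) ≤ Q) :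
    (u₁ + u₂) / 2 * ((v₁ + v₂) / 2) ^ 2 + 2 * Q ^ 2 / ((u₁ + u₂) / 2)
        + (v₂ - v₁) ^ 2 * ((u₁ + u₂) / 2) / 8 ≤
      ((u₁ * v₁ ^ 2 + 2 * Q ^ 2 / u₁) + (u₂ * v₂ ^ 2 + 2 * Q ^ 2 / u₂)) / 2 := by
  obtain ⟨u, hu⟩ : ∃ u, u = (u₁ + u₂) / 2 := ⟨_, rfl⟩
  obtain ⟨v, hv⟩ : ∃ v, v = (v₁ + v₂) / 2 := ⟨_, rfl⟩
  obtain ⟨s, hs⟩ : ∃ s, s = (u₂ - u₁) / 2 := ⟨_, rfl⟩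
  obtain ⟨t, ht⟩ : ∃ t, t = (v₂ - v₁) / 2 := ⟨_, rfl⟩
  obtain rfl : u₁ = u - s := by linarith
  obtain rfl : u₂ = u + s := by linarith
  obtain rfl : v₁ = v - t := by linarith
  obtain rfl : v₂ = v + t := by linarith
  rw [← hu, ← hv] at *
  have hu0 : 0 < u := by linarith
  have hv0 : 0 < v := by linarith
  have hinv : (1 / (u - s) + 1 / (u + s)) / 2 - 1 / u ≥ s ^ 2 / u ^ 3 := by
    have h : (1 / (u - s) + 1 / (u + s)) / 2 - 1 / u = s ^ 2 / (u * ((u - s) * (u + s))) := by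
      field_simp
      ring
    rw [h]
    apply div_le_div_of_nonneg_left (sq_nonneg s) (by positivity)
    nlinarith [mul_nonneg hu0.le (sq_nonneg s)]
  have hQ2 : (u * v) ^ 2 ≤ Q ^ 2 := pow_le_pow_left₀ (by positivity) hQ 2
  have hmul : 2 * (u * v) ^ 2 * (s ^ 2 / u ^ 3) ≤
      2 * Q ^ 2 * ((1 / (u - s) + 1 / (u + s)) / 2 - 1 / u) := by
    gcongr
  have hsq : 2 * (u * v) ^ 2 * (s ^ 2 / u ^ 3) + u * t ^ 2 / 2 + 2 * v * s * t =
      (u * t + 2 * v * s) ^ 2 / (2 * u) := by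
    field_simp
    ring
  have hpos : 0 ≤ (u * t + 2 * v * s) ^ 2 / (2 * u) := by positivity
  have e : ∀ y : ℝ, 2 * Q ^ 2 / y = 2 * Q ^ 2 * (1 / y) := fun y => by ring
  rw [e, e, e]
  nlinarith

/-- Convexity of `(x, m) ↦ x² / m` together with a concavity defect `δ` in the variable `m`. -/
lemma sq_div_defect {x₁ x₂ m₁ m₂ m v δ : ℝ} (hm₁ : 0 < m₁) (hm₂ : 0 < m₂) (hδ : 0 ≤ δ)
    (hm : (m₁ + m₂) / 2 + δ ≤ m) (hmv : m ≤ 2 * v) :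
    (((x₁ + x₂) / 2) / v) ^ 2 * δ / 4 + ((x₁ + x₂) / 2) ^ 2 / m ≤
      (x₁ ^ 2 / m₁ + x₂ ^ 2 / m₂) / 2 := by
  obtain ⟨M, hM⟩ : ∃ M, M = (m₁ + m₂) / 2 := ⟨_, rfl⟩
  obtain ⟨x, hx⟩ : ∃ x, x = (x₁ + x₂) / 2 := ⟨_, rfl⟩
  rw [← hM] at hm
  rw [← hx]
  have hM0 : 0 < M := by linarith
  have hm0 : 0 < m := by linarith
  have hv0 : 0 < v := by linarith
  have hconv : x ^ 2 / M ≤ (x₁ ^ 2 / m₁ + x₂ ^ 2 / m₂) / 2 := by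
    have h : (x₁ ^ 2 / m₁ + x₂ ^ 2 / m₂) / 2 - x ^ 2 / M =
        (x₁ * m₂ - x₂ * m₁) ^ 2 / (2 * m₁ * m₂ * (m₁ + m₂)) := by
      rw [hx, hM]
      field_simp
      ring
    have : 0 ≤ (x₁ * m₂ - x₂ * m₁) ^ 2 / (2 * m₁ * m₂ * (m₁ + m₂)) := by positivity
    linarith
  have hgap : (x / v) ^ 2 * δ / 4 ≤ x ^ 2 / M - x ^ 2 / m := by
    have h1 : x ^ 2 / M - x ^ 2 / m = x ^ 2 * (m - M) / (M * m) := by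
      field_simp
    have h2 : (x / v) ^ 2 * δ / 4 = x ^ 2 * δ / (2 * v * (2 * v)) := by
      field_simp
      ring
    have hδM : δ ≤ m - M := by linarith
    have hMv : M ≤ 2 * v := by linarith
    rw [h1, h2]
    have hnum : 0 ≤ x ^ 2 * (m - M) := mul_nonneg (sq_nonneg x) (hδ.trans hδM)
    gcongr
  linarith

/-- The concave auxiliary quantity `2 v - (u v² + 2 Q² / u) / (3 Q²)`. -/
def bellmanDenom (Q u v : ℝ) : ℝ := 2 * v - (u * v ^ 2 + 2 * Q ^ 2 / u) / (3 * Q ^ 2)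

lemma le_bellmanDenom {Q u v : ℝ} (hQ : 1 < Q) (hu : 0 < u) (hv : 0 < v) (h1 : 1 ≤ u * v)
    (h2 : u * v ≤ Q) : v ≤ bellmanDenom Q u v := by
  have hinv : 1 / u ≤ v := by rwa [div_le_iff₀' hu]
  have h : (u * v ^ 2 + 2 * Q ^ 2 / u) / (3 * Q ^ 2) ≤ v := by
    rw [div_le_iff₀ (by positivity)]
    have e1 : 2 * Q ^ 2 / u = 2 * Q ^ 2 * (1 / u) := by ring
    have e2 : 2 * Q ^ 2 * (1 / u) ≤ 2 * Q ^ 2 * v := by gcongr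
    have e3 : u * v ^ 2 ≤ Q ^ 2 * v := by
      have : u * v ≤ Q ^ 2 := by nlinarith
      nlinarith
    linarith
  unfold bellmanDenom
  linarith

lemma bellmanDenom_le {Q u v : ℝ} (hu : 0 < u) : bellmanDenom Q u v ≤ 2 * v := by
  have : 0 ≤ (u * v ^ 2 + 2 * Q ^ 2 / u) / (3 * Q ^ 2) := by positivity
  unfold bellmanDenom
  linarith

/-- The one-step inequality for the Bellman function `F - x² / bellmanDenom Q u v`. -/
lemma bellman_step {Q u₁ u₂ v₁ v₂ x₁ x₂ : ℝ} (hQ : 1 < Q) (hu₁ : 0 < u₁) (hu₂ : 0 < u₂)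
    (hv₁ : 0 < v₁) (hv₂ : 0 < v₂) (h₁ : 1 ≤ u₁ * v₁) (h₂ : 1 ≤ u₂ * v₂) (hQ₁ : u₁ * v₁ ≤ Q)
    (hQ₂ : u₂ * v₂ ≤ Q) (h : (u₁ + u₂) / 2 * ((v₁ + v₂) / 2) ≤ Q) :
    (((x₁ + x₂) / 2) / ((v₁ + v₂) / 2)) ^ 2 * ((v₂ - v₁) ^ 2 * ((u₁ + u₂) / 2)) ≤
      96 * Q ^ 2 * ((x₁ ^ 2 / bellmanDenom Q u₁ v₁ + x₂ ^ 2 / bellmanDenom Q u₂ v₂) / 2 -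
        ((x₁ + x₂) / 2) ^ 2 / bellmanDenom Q ((u₁ + u₂) / 2) ((v₁ + v₂) / 2)) := by
  have hQ0 : 0 < 3 * Q ^ 2 := by positivity
  have hδ : (bellmanDenom Q u₁ v₁ + bellmanDenom Q u₂ v₂) / 2 +
      (v₂ - v₁) ^ 2 * ((u₁ + u₂) / 2) / 8 / (3 * Q ^ 2) ≤
      bellmanDenom Q ((u₁ + u₂) / 2) ((v₁ + v₂) / 2) := by
    have hc := div_le_div_of_nonneg_right (bellman_convexity hu₁ hu₂ hv₁ hv₂ h) hQ0.le
    rw [add_div _ _ (3 * Q ^ 2), div_right_comm _ 2 (3 * Q ^ 2),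
      add_div (u₁ * v₁ ^ 2 + 2 * Q ^ 2 / u₁)] at hc
    unfold bellmanDenom
    linarith
  have hd := sq_div_defect (x₁ := x₁) (x₂ := x₂)
    (hv₁.trans_le (le_bellmanDenom hQ hu₁ hv₁ h₁ hQ₁))
    (hv₂.trans_le (le_bellmanDenom hQ hu₂ hv₂ h₂ hQ₂)) (by positivity) hδ
    (bellmanDenom_le (by positivity))
  have hm := mul_le_mul_of_nonneg_left (le_sub_iff_add_le.mpr hd) (by positivity : 0 ≤ 96 * Q ^ 2)
  refine le_trans (le_of_eq ?_) hm
  field_simp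
  ring

/-- Splitting a sum over the descendants of a dyadic interval into its top term and the sums over
the descendants of the two halves. -/
lemma sum_dyadic_succ (f : ℕ → ℕ → ℝ) (n k N : ℕ) :
    ∑ p ∈ Finset.range (N + 1), ∑ r ∈ Finset.range (2 ^ p), f (n + p) (2 ^ p * k + r) =
      f n k + ∑ p ∈ Finset.range N, ∑ r ∈ Finset.range (2 ^ p),
          f (n + 1 + p) (2 ^ p * (2 * k) + r) +
        ∑ p ∈ Finset.range N, ∑ r ∈ Finset.range (2 ^ p),
          f (n + 1 + p) (2 ^ p * (2 * k + 1) + r) := by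
  rw [Finset.sum_range_succ', add_comm, add_assoc, ← Finset.sum_add_distrib]
  congr 1
  · simp
  · refine Finset.sum_congr rfl fun p _ => ?_
    rw [pow_succ, mul_two, Finset.sum_range_add]
    congr 1 <;> refine Finset.sum_congr rfl fun r _ => ?_ <;> congr 1 <;> ring

/-- The embedding estimate for abstract families of averages `u = ⟨w⟩`, `v = ⟨w⁻¹⟩`,
`x = ⟨φ w⁻¹⟩`, `F = ⟨φ² w⁻¹⟩` indexed by dyadic intervals. -/
lemma dyadic_embedding {Q : ℝ} (hQ : 1 < Q) {u v x F : ℕ → ℕ → ℝ}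
    (hu : ∀ n k, k < 2 ^ n → u n k = (u (n + 1) (2 * k) + u (n + 1) (2 * k + 1)) / 2)
    (hv : ∀ n k, k < 2 ^ n → v n k = (v (n + 1) (2 * k) + v (n + 1) (2 * k + 1)) / 2)
    (hx : ∀ n k, k < 2 ^ n → x n k = (x (n + 1) (2 * k) + x (n + 1) (2 * k + 1)) / 2)
    (hF : ∀ n k, k < 2 ^ n → F n k = (F (n + 1) (2 * k) + F (n + 1) (2 * k + 1)) / 2)
    (hu0 : ∀ n k, k < 2 ^ n → 0 < u n k) (hv0 : ∀ n k, k < 2 ^ n → 0 < v n k)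
    (huv : ∀ n k, k < 2 ^ n → 1 ≤ u n k * v n k) (huvQ : ∀ n k, k < 2 ^ n → u n k * v n k ≤ Q)
    (hxF : ∀ n k, k < 2 ^ n → x n k ^ 2 ≤ F n k * v n k) (N n k : ℕ) (hk : k < 2 ^ n) :
    ∑ p ∈ Finset.range N, ∑ r ∈ Finset.range (2 ^ p),
      (x (n + p) (2 ^ p * k + r) / v (n + p) (2 ^ p * k + r)) ^ 2 *
        ((v (n + p + 1) (2 * (2 ^ p * k + r) + 1) - v (n + p + 1) (2 * (2 ^ p * k + r))) ^ 2 *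
          u (n + p) (2 ^ p * k + r)) * dyadicLen (n + p) ≤
      96 * Q ^ 2 * dyadicLen n * (F n k - x n k ^ 2 / bellmanDenom Q (u n k) (v n k)) := by
  induction N generalizing n k with
  | zero =>
    have hle := le_bellmanDenom hQ (hu0 n k hk) (hv0 n k hk) (huv n k hk) (huvQ n k hk)
    have h1 : x n k ^ 2 / bellmanDenom Q (u n k) (v n k) ≤ F n k :=
      (div_le_div_of_nonneg_left (sq_nonneg _) (hv0 n k hk) hle).trans
        ((div_le_iff₀ (hv0 n k hk)).mpr (hxF n k hk))
    have h2 : 0 ≤ dyadicLen n := by unfold dyadicLen; positivity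
    have h3 := sub_nonneg.mpr h1
    simpa using by positivity
  | succ N ih =>
    have hl : 2 * k < 2 ^ (n + 1) := by rw [pow_succ]; omega
    have hr : 2 * k + 1 < 2 ^ (n + 1) := by rw [pow_succ]; omega
    have hlen : dyadicLen n = 2 * dyadicLen (n + 1) := by
      unfold dyadicLen
      rw [pow_succ]
      field_simp
    have hlen0 : 0 ≤ dyadicLen (n + 1) := by unfold dyadicLen; positivity
    rw [sum_dyadic_succ fun n k => (x n k / v n k) ^ 2 *
      ((v (n + 1) (2 * k + 1) - v (n + 1) (2 * k)) ^ 2 * u n k) * dyadicLen n]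
    have hstep := bellman_step (x₁ := x (n + 1) (2 * k)) (x₂ := x (n + 1) (2 * k + 1)) hQ
      (hu0 _ _ hl) (hu0 _ _ hr) (hv0 _ _ hl) (hv0 _ _ hr) (huv _ _ hl) (huv _ _ hr)
      (huvQ _ _ hl) (huvQ _ _ hr) (by rw [← hu n k hk, ← hv n k hk]; exact huvQ n k hk)
    rw [← hu n k hk, ← hv n k hk, ← hx n k hk] at hstep
    have hmul := mul_le_mul_of_nonneg_right hstep hlen0
    have ihl := ih (n + 1) (2 * k) hl
    have ihr := ih (n + 1) (2 * k + 1) hr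
    rw [hF n k hk, hlen]
    linarith

lemma dyadicI_subset {n k : ℕ} (hk : k < 2 ^ n) : dyadicI n k ⊆ Set.Ico 0 1 := by
  refine Set.Ico_subset_Ico (by positivity) ?_
  rw [div_le_one (by positivity)]
  exact_mod_cast hk

lemma avg_eq_half_add {f : ℝ → ℝ} (hf : IntegrableOn f (Set.Ico 0 1)) {n k : ℕ}
    (hk : k < 2 ^ n) :
    avg f n k = (avg f (n + 1) (2 * k) + avg f (n + 1) (2 * k + 1)) / 2 := by
  have hl : 2 * k < 2 ^ (n + 1) := by rw [pow_succ]; omega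
  have hr : 2 * k + 1 < 2 ^ (n + 1) := by rw [pow_succ]; omega
  have hp : (0 : ℝ) < 2 ^ n := by positivity
  have hunion : dyadicI n k = dyadicI (n + 1) (2 * k) ∪ dyadicI (n + 1) (2 * k + 1) := by
    have e1 : (k : ℝ) / 2 ^ n = ((2 * k : ℕ) : ℝ) / 2 ^ (n + 1) := by
      push_cast; rw [pow_succ]; field_simp
    have e2 : ((k : ℝ) + 1) / 2 ^ n = (((2 * k + 1 : ℕ) : ℝ) + 1) / 2 ^ (n + 1) := by
      push_cast; rw [pow_succ]; field_simp; ring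
    have e3 : ((2 * k + 1 : ℕ) : ℝ) = ((2 * k : ℕ) : ℝ) + 1 := by push_cast; ring
    unfold dyadicI
    rw [e1, e2, e3, Set.Ico_union_Ico_eq_Ico] <;> gcongr <;> linarith
  have hdisj : Disjoint (dyadicI (n + 1) (2 * k)) (dyadicI (n + 1) (2 * k + 1)) := by
    unfold dyadicI
    push_cast
    exact Set.Ico_disjoint_Ico_same
  unfold avg
  rw [hunion, setIntegral_union hdisj measurableSet_Ico (hf.mono_set (dyadicI_subset hl))
    (hf.mono_set (dyadicI_subset hr)), pow_succ]
  ring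

lemma avg_pos {f : ℝ → ℝ} (hf : IntegrableOn f (Set.Ico 0 1))
    (hpos : ∀ y ∈ Set.Ico (0 : ℝ) 1, 0 < f y) {n k : ℕ} (hk : k < 2 ^ n) : 0 < avg f n k := by
  refine mul_pos (by positivity) ?_
  have hsub := dyadicI_subset hk
  have hsupp : dyadicI n k ⊆ Function.support f := fun y hy => (hpos y (hsub hy)).ne'
  rw [setIntegral_pos_iff_support_of_nonneg_ae (s := dyadicI n k)
    ((ae_restrict_iff' measurableSet_Ico).mpr (.of_forall fun y hy => (hpos y (hsub hy)).le))
    (hf.mono_set hsub), Set.inter_eq_self_of_subset_right hsupp]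
  simp only [dyadicI, Real.volume_Ico, ENNReal.ofReal_pos, sub_pos]
  gcongr
  linarith

/-- Cauchy–Schwarz for averages, in the form `⟨g⟩² ≤ ⟨f⟩ ⟨p⟩` when `g² = f p` pointwise. -/
lemma sq_avg_le {f g p : ℝ → ℝ} (hf : IntegrableOn f (Set.Ico 0 1))
    (hg : IntegrableOn g (Set.Ico 0 1)) (hp : IntegrableOn p (Set.Ico 0 1))
    (hpos : ∀ y ∈ Set.Ico (0 : ℝ) 1, 0 < p y)
    (hfg : ∀ y ∈ Set.Ico (0 : ℝ) 1, g y ^ 2 = f y * p y) {n k : ℕ} (hk : k < 2 ^ n) :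
    avg g n k ^ 2 ≤ avg f n k * avg p n k := by
  have hsub := dyadicI_subset hk
  have hp0 := avg_pos hp hpos hk
  have hquad : ∀ c : ℝ, 0 ≤ avg f n k - 2 * c * avg g n k + c ^ 2 * avg p n k := by
    intro c
    have hint : 0 ≤ ∫ y in dyadicI n k, (f y - 2 * c * g y + c ^ 2 * p y) := by
      refine setIntegral_nonneg measurableSet_Ico fun y hy => ?_
      have h := hpos y (hsub hy)
      have e : f y - 2 * c * g y + c ^ 2 * p y = (g y - c * p y) ^ 2 / p y := by
        field_simp
        linear_combination -hfg y (hsub hy)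
      rw [e]
      positivity
    have hf' := hf.mono_set hsub
    have hg' := (hg.mono_set hsub).const_mul (2 * c)
    have hp' := (hp.mono_set hsub).const_mul (c ^ 2)
    rw [integral_add (f := fun y => f y - 2 * c * g y) (hf'.sub hg') hp', integral_sub hf' hg',
      integral_const_mul, integral_const_mul] at hint
    have := mul_nonneg (by positivity : (0 : ℝ) ≤ 2 ^ n) hint
    unfold avg
    linarith
  have h := hquad (avg g n k / avg p n k)
  have e : avg f n k - 2 * (avg g n k / avg p n k) * avg g n k +
      (avg g n k / avg p n k) ^ 2 * avg p n k = avg f n k - avg g n k ^ 2 / avg p n k := by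
    field_simp
    ring
  rw [e, sub_nonneg, div_le_iff₀ hp0] at h
  exact h

lemma avg_one (n k : ℕ) : avg (fun _ => 1) n k = 1 := by
  have h : ((k : ℝ) + 1) / 2 ^ n - k / 2 ^ n = 1 / 2 ^ n := by ring
  simp [avg, dyadicI, h]

/-- there is an absolute constant `A > 0` such that for every `Q > 1`, every
weight `w` on `[0,1)` with `[w]_{A₂} ≤ Q`, every `φ` with `∫ φ² w⁻¹ < ∞`, and every dyadic
interval `J = (n,k)`,
`(1/|J|) Σ_{I ∈ D(J)} (⟨φ w⁻¹⟩_I / ⟨w⁻¹⟩_I)² γ_I |I| ≤ A Q² ⟨φ² w⁻¹⟩_J`,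
where `γ_I = (Δ_I w⁻¹)² ⟨w⟩_I`.  (The sum over `D(J)` is expressed through all its finite
partial sums over generations `p < N`.) -/
theorem embedding_estimate_squareFunction :
    ∃ A : ℝ, 0 < A ∧
      ∀ Q : ℝ, 1 < Q →
      ∀ w : ℝ → ℝ, Measurable w →
        (∀ x ∈ Set.Ico (0 : ℝ) 1, 0 < w x) →
        IntegrableOn w (Set.Ico (0 : ℝ) 1) →
        IntegrableOn (fun x => (w x)⁻¹) (Set.Ico (0 : ℝ) 1) →
        (∀ n k : ℕ, k < 2 ^ n →
          avg w n k * avg (fun x => (w x)⁻¹) n k ≤ Q) →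
        ∀ φ : ℝ → ℝ, Measurable φ →
          IntegrableOn (fun x => φ x ^ 2 * (w x)⁻¹) (Set.Ico (0 : ℝ) 1) →
        ∀ n k : ℕ, k < 2 ^ n → ∀ N : ℕ,
          (1 / dyadicLen n) *
            ∑ p ∈ Finset.range N, ∑ r ∈ Finset.range (2 ^ p),
              (avg (fun x => φ x * (w x)⁻¹) (n + p) (2 ^ p * k + r) /
                  avg (fun x => (w x)⁻¹) (n + p) (2 ^ p * k + r)) ^ 2 *
                gammaI w (n + p) (2 ^ p * k + r) * dyadicLen (n + p)
          ≤ A * Q ^ 2 * avg (fun x => φ x ^ 2 * (w x)⁻¹) n k := by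
  refine ⟨96, by norm_num, fun Q hQ w hwm hw hwi hσi hA φ hφm hφi n k hk N => ?_⟩
  have hσ : ∀ y ∈ Set.Ico (0 : ℝ) 1, 0 < (w y)⁻¹ := fun y hy => inv_pos.mpr (hw y hy)
  have hφσ : IntegrableOn (fun y => φ y * (w y)⁻¹) (Set.Ico 0 1) := by
    refine (hφi.add hσi).mono' (hφm.mul hwm.inv).aestronglyMeasurable
      ((ae_restrict_iff' measurableSet_Ico).mpr (.of_forall fun y hy => ?_))
    have h := hσ y hy
    simp only [Pi.add_apply, norm_mul, Real.norm_eq_abs, abs_of_pos h]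
    rw [← sq_abs]
    nlinarith [mul_nonneg h.le (sq_nonneg (|φ y| - 1)), mul_nonneg h.le (abs_nonneg (φ y))]
  have hpos : ∀ n k, k < 2 ^ n → 1 ≤ avg w n k * avg (fun y => (w y)⁻¹) n k := by
    intro n k hk
    have h := sq_avg_le (g := fun _ => 1) hwi (integrableOn_const (by simp)) hσi hσ
      (fun y hy => by rw [mul_inv_cancel₀ (hw y hy).ne', one_pow]) hk
    rwa [avg_one, one_pow] at h
  have hmain := dyadic_embedding hQ (fun _ _ => avg_eq_half_add hwi)
    (fun _ _ => avg_eq_half_add hσi) (fun _ _ => avg_eq_half_add hφσ)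
    (fun _ _ => avg_eq_half_add hφi) (fun _ _ => avg_pos hwi hw) (fun _ _ => avg_pos hσi hσ)
    hpos hA (fun _ _ => sq_avg_le hφi hφσ hσi hσ fun y _ => by ring) N n k hk
  have hlen : 0 < dyadicLen n := by unfold dyadicLen; positivity
  have hnonneg : 0 ≤ avg (fun y => φ y * (w y)⁻¹) n k ^ 2 /
      bellmanDenom Q (avg w n k) (avg (fun y => (w y)⁻¹) n k) :=
    div_nonneg (sq_nonneg _) ((avg_pos hσi hσ hk).le.trans (le_bellmanDenom hQ
      (avg_pos hwi hw hk) (avg_pos hσi hσ hk) (hpos n k hk) (hA n k hk)))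
  rw [one_div, inv_mul_le_iff₀ hlen]
  refine hmain.trans ?_
  rw [mul_right_comm, mul_comm]
  gcongr
  exact sub_le_self _ hnonneg
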